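/- Under conditions (C.1), (C.2), (C.5), with (C.4) holding with B = 0 (i.e., E[‖Y_t‖² | ℱ_t] ≤ A a.s.), and assuming (C(w_t) − C(w*))/‖∇C(w_t)‖² ≤ D < ∞ almost surely for all t, the expected suboptimality satisfies the recursive inequality: E[C(w_{t+1})] − C(w*) ≤ (E[C(w_t)] − C(w*))·(1 − a_t m / D) + A K M² a_t² for every t. -/

import Mathlib

open MeasureTheory Filter
open scoped Topology RealInnerProductSpace

section

variable {E : Type*} [NormedAddCommGroup E] [InnerProductSpace ℝ E]

/-- A symmetric operator whose quadratic form takes values between `0` and `M * ‖v‖ ^ 2` has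
operator norm at most `M`. -/
theorem norm_apply_le_of_symmetric_of_inner_le {T : E →L[ℝ] E} {M : ℝ} (hM : 0 < M)
    (hsymm : ∀ u v, ⟪T u, v⟫ = ⟪u, T v⟫) (hnonneg : ∀ v, 0 ≤ ⟪v, T v⟫)
    (hle : ∀ v, ⟪v, T v⟫ ≤ M * ‖v‖ ^ 2) (v : E) : ‖T v‖ ≤ M * ‖v‖ := by
  have key := hnonneg (M • v - T v)
  have expand : ⟪M • v - T v, T (M • v - T v)⟫ =
      M ^ 2 * ⟪v, T v⟫ - 2 * M * ‖T v‖ ^ 2 + ⟪T v, T (T v)⟫ := by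
    simp only [map_sub, map_smul, inner_sub_left, inner_sub_right, real_inner_smul_left,
      real_inner_smul_right, ← hsymm v (T v), real_inner_self_eq_norm_sq]
    ring
  have hv := mul_le_mul_of_nonneg_left (hle v) (sq_nonneg M)
  have hTv := hle (T v)
  refine abs_le_of_sq_le_sq' (le_of_mul_le_mul_left ?_ hM) (by positivity) |>.2
  rw [expand] at key
  linarith [mul_pow M ‖v‖ 2]

variable [CompleteSpace E]

theorem ContDiff.differentiable_gradient {f : E → ℝ} (hf : ContDiff ℝ 2 f) :
    Differentiable ℝ (gradient f) :=
  (InnerProductSpace.toDual ℝ E).symm.differentiable.comp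
    ((hf.fderiv_right (m := 1) (by norm_num)).differentiable (by norm_num))

/-- **Descent lemma**: a second-order upper bound for a function whose Hessian is bounded. -/
theorem ContDiff.le_add_inner_gradient_of_norm_fderiv_gradient_le {f : E → ℝ}
    (hf : ContDiff ℝ 2 f) {K : ℝ} (hK : ∀ v, ‖fderiv ℝ (gradient f) v‖ ≤ 2 * K) (x d : E) :
    f (x + d) ≤ f x + ⟪gradient f x, d⟫ + K * ‖d‖ ^ 2 := by
  have hdiff : Differentiable ℝ f := hf.differentiable (by norm_num)
  have hline (s : ℝ) : HasDerivAt (fun s : ℝ => x + s • d) d s := by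
    simpa using ((hasDerivAt_id s).smul_const d).const_add x
  have hderiv (s : ℝ) : HasDerivAt
      (fun s : ℝ => f (x + s • d) - s * ⟪gradient f x, d⟫ - s ^ 2 * (K * ‖d‖ ^ 2))
      (⟪gradient f (x + s • d), d⟫ - ⟪gradient f x, d⟫ - 2 * s * (K * ‖d‖ ^ 2)) s := by
    have h₁ := (hdiff (x + s • d)).hasFDerivAt.comp_hasDerivAt s (hline s)
    rw [← inner_gradient_left] at h₁
    have h₂ := (hasDerivAt_id' s).mul_const ⟪gradient f x, d⟫
    have h₃ := (hasDerivAt_pow 2 s).mul_const (K * ‖d‖ ^ 2)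
    exact ((h₁.sub h₂).sub h₃).congr_deriv (by simp)
  have hanti : AntitoneOn
      (fun s : ℝ => f (x + s • d) - s * ⟪gradient f x, d⟫ - s ^ 2 * (K * ‖d‖ ^ 2))
      (Set.Icc 0 1) := by
    refine antitoneOn_of_hasDerivWithinAt_nonpos (convex_Icc 0 1)
      (fun s _ => (hderiv s).continuousAt.continuousWithinAt)
      (fun s _ => (hderiv s).hasDerivWithinAt) fun s hs => ?_
    have hs0 : 0 ≤ s := (interior_subset hs).1
    have hlip := convex_univ.norm_image_sub_le_of_norm_fderiv_le
      (fun v _ => hf.differentiable_gradient v) (fun v _ => hK v)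
      (Set.mem_univ x) (Set.mem_univ (x + s • d))
    rw [add_sub_cancel_left, norm_smul, Real.norm_of_nonneg hs0] at hlip
    have hcs := real_inner_le_norm (gradient f (x + s • d) - gradient f x) d
    rw [inner_sub_left] at hcs
    linarith [mul_le_mul_of_nonneg_right hlip (norm_nonneg d)]
  have := hanti (Set.left_mem_Icc.2 zero_le_one) (Set.right_mem_Icc.2 zero_le_one) zero_le_one
  simp only [one_smul, zero_smul, add_zero] at this
  linarith

end

/-- Integrating an inner product against a square-integrable `m`-measurable vector, the other factor
may be replaced by its conditional expectation with respect to `m`. -/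
theorem integral_inner_eq_of_condExp_ae_eq {E Ω : Type*} [NormedAddCommGroup E]
    [InnerProductSpace ℝ E] [CompleteSpace E] {m m0 : MeasurableSpace Ω} {μ : Measure Ω}
    [IsFiniteMeasure μ] (hm : m ≤ m0) {X Y G : Ω → E} (hX : StronglyMeasurable[m] X)
    (hY : Integrable Y μ) (hXY : Integrable (fun ω => ⟪X ω, Y ω⟫) μ) (hG : μ[Y | m] =ᵐ[μ] G) :
    ∫ ω, ⟪X ω, Y ω⟫ ∂μ = ∫ ω, ⟪X ω, G ω⟫ ∂μ := by
  rw [← integral_condExp hm]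
  refine integral_congr_ae ((condExp_bilin_of_stronglyMeasurable_left
    (innerSL ℝ) hX hXY hY).trans ?_)
  filter_upwards [hG] with ω hω
  exact congrArg (fun y => ⟪X ω, y⟫) hω

/-- **Recursive inequality for the expected suboptimality** (inequality (17)/(18)
of the paper). Under (C.1), (C.2), (C.5), (C.4) with `B = 0`, and the ratio
condition `(C (w t) - C w*) ≤ D ‖∇C (w t)‖²` a.s., for every `t`:
`E[C (w (t+1))] - C w* ≤ (E[C (w t)] - C w*) (1 - a t m / D) + A K M² a t ²`. -/
theorem expected_suboptimality_recursion
    {n : ℕ} {Ω : Type*} {m0 : MeasurableSpace Ω}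
    {μ : Measure Ω} [IsProbabilityMeasure μ] (ℱ : Filtration ℕ m0)
    (C : EuclideanSpace ℝ (Fin n) → ℝ)
    (hC : ContDiff ℝ 2 C)
    (wstar : EuclideanSpace ℝ (Fin n))
    (hmin : ∀ v, C wstar ≤ C v)
    (w Y : ℕ → Ω → EuclideanSpace ℝ (Fin n))
    (B : ℕ → Ω → (EuclideanSpace ℝ (Fin n) →L[ℝ] EuclideanSpace ℝ (Fin n)))
    (a : ℕ → ℝ) (ha : ∀ t, 0 < a t)
    (hw_meas : ∀ t, StronglyMeasurable[ℱ t] (w t))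
    (hB_meas : ∀ t, StronglyMeasurable[ℱ t] (B t))
    (hY_meas : ∀ t, StronglyMeasurable[ℱ (t + 1)] (Y t))
    (hY_int : ∀ t, Integrable (Y t) μ)
    (hCw_int : ∀ t, Integrable (fun ω => C (w t ω)) μ)
    (hgrad_int : ∀ t, Integrable (fun ω => ‖gradient C (w t ω)‖ ^ 2) μ)
    (hupdate : ∀ t ω, w (t + 1) ω = w t ω - a t • (B t ω) (Y t ω))
    -- (C.1)
    (hC1 : ∀ t, μ[Y t | ℱ t] =ᵐ[μ] fun ω => gradient C (w t ω))
    -- (C.2)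
    (K : ℝ) (hC2 : ∀ v, ‖fderiv ℝ (gradient C) v‖ ≤ 2 * K)
    -- (C.4) with B = 0
    (A : ℝ) (hA : 0 ≤ A)
    (hYsq_int : ∀ t, Integrable (fun ω => ‖Y t ω‖ ^ 2) μ)
    (hC4 : ∀ t, ∀ᵐ ω ∂μ, (μ[fun ω' => ‖Y t ω'‖ ^ 2 | ℱ t]) ω ≤ A)
    -- (C.5)
    (m M : ℝ) (hm : 0 < m) (hmM : m < M)
    (hC5 : ∀ t, ∀ᵐ ω ∂μ,
      (∀ u v, ⟪(B t ω) u, v⟫ = ⟪u, (B t ω) v⟫) ∧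
        ∀ v, m * ‖v‖ ^ 2 ≤ ⟪v, (B t ω) v⟫ ∧ ⟪v, (B t ω) v⟫ ≤ M * ‖v‖ ^ 2)
    -- ratio condition
    (D : ℝ) (hD : 0 < D)
    (hratio : ∀ t, ∀ᵐ ω ∂μ,
      C (w t ω) - C wstar ≤ D * ‖gradient C (w t ω)‖ ^ 2) :
    ∀ t, (∫ ω, C (w (t + 1) ω) ∂μ) - C wstar ≤
      ((∫ ω, C (w t ω) ∂μ) - C wstar) * (1 - a t * m / D)
        + A * K * M ^ 2 * (a t) ^ 2 := by
  intro t
  have hM : 0 < M := hm.trans hmM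
  have hK : 0 ≤ K := by linarith [(norm_nonneg _).trans (hC2 wstar)]
  have hat := ha t
  set G : Ω → EuclideanSpace ℝ (Fin n) := fun ω => gradient C (w t ω)
  have hG_meas : StronglyMeasurable[ℱ t] G :=
    hC.differentiable_gradient.continuous.comp_stronglyMeasurable (hw_meas t)
  have hBG_meas : StronglyMeasurable[ℱ t] fun ω => B t ω (G ω) :=
    (continuous_fst.clm_apply continuous_snd).comp_stronglyMeasurable
      ((hB_meas t).prodMk hG_meas)
  have hBnorm : ∀ᵐ ω ∂μ, ∀ v, ‖B t ω v‖ ≤ M * ‖v‖ := by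
    filter_upwards [hC5 t] with ω hω v
    exact norm_apply_le_of_symmetric_of_inner_le hM hω.1
      (fun v => (by positivity : 0 ≤ m * ‖v‖ ^ 2).trans (hω.2 v).1) (fun v => (hω.2 v).2) v
  have hint_inner {Z : Ω → EuclideanSpace ℝ (Fin n)} (hZ : AEStronglyMeasurable Z μ)
      (hZsq : Integrable (fun ω => ‖Z ω‖ ^ 2) μ) :
      Integrable (fun ω => ⟪B t ω (G ω), Z ω⟫) μ := by
    refine (((hgrad_int t).add hZsq).const_mul M).mono'
      ((hBG_meas.mono (ℱ.le t)).aestronglyMeasurable.inner hZ) ?_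
    filter_upwards [hBnorm] with ω hω
    calc ‖⟪B t ω (G ω), Z ω⟫‖ ≤ ‖B t ω (G ω)‖ * ‖Z ω‖ := norm_inner_le_norm _ _
      _ ≤ M * ‖G ω‖ * ‖Z ω‖ := by gcongr; exact hω _
      _ = M * (‖G ω‖ * ‖Z ω‖) := by ring
      _ ≤ M * (‖G ω‖ ^ 2 + ‖Z ω‖ ^ 2) := by
        gcongr
        nlinarith [sq_nonneg (‖G ω‖ - ‖Z ω‖), sq_nonneg ‖G ω‖, sq_nonneg ‖Z ω‖]
  have hBGY := hint_inner (hY_int t).1 (hYsq_int t)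
  have hBGG := hint_inner (hG_meas.mono (ℱ.le t)).aestronglyMeasurable (hgrad_int t)
  have hcross := integral_inner_eq_of_condExp_ae_eq (ℱ.le t) hBG_meas (hY_int t) hBGY (hC1 t)
  have hsecond : ∫ ω, ‖Y t ω‖ ^ 2 ∂μ ≤ A := by
    rw [← integral_condExp (ℱ.le t)]
    simpa using integral_mono_ae integrable_condExp (integrable_const A) (hC4 t)
  have hdrift : m / D * ((∫ ω, C (w t ω) ∂μ) - C wstar) ≤ ∫ ω, ⟪B t ω (G ω), G ω⟫ ∂μ := by
    have hsub : ∫ ω, m / D * (C (w t ω) - C wstar) ∂μ =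
        m / D * ((∫ ω, C (w t ω) ∂μ) - C wstar) := by
      rw [integral_const_mul, integral_sub (hCw_int t) (integrable_const _)]
      simp
    rw [← hsub]
    refine integral_mono_ae (((hCw_int t).sub (integrable_const _)).const_mul _) hBGG ?_
    filter_upwards [hC5 t, hratio t] with ω hω hr
    calc m / D * (C (w t ω) - C wstar) ≤ m / D * (D * ‖G ω‖ ^ 2) := by gcongr
      _ = m * ‖G ω‖ ^ 2 := by field_simp
      _ ≤ ⟪B t ω (G ω), G ω⟫ := by
        rw [real_inner_comm]
        exact (hω.2 _).1
  have hdiff : Integrable (fun ω => C (w t ω) - a t * ⟪B t ω (G ω), Y t ω⟫) μ :=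
    (hCw_int t).sub (hBGY.const_mul _)
  have hstep : ∫ ω, C (w (t + 1) ω) ∂μ ≤ (∫ ω, C (w t ω) ∂μ)
      - a t * (∫ ω, ⟪B t ω (G ω), Y t ω⟫ ∂μ)
      + K * M ^ 2 * a t ^ 2 * ∫ ω, ‖Y t ω‖ ^ 2 ∂μ := by
    rw [← integral_const_mul, ← integral_const_mul,
      ← integral_sub (hCw_int t) (hBGY.const_mul _),
      ← integral_add hdiff ((hYsq_int t).const_mul _)]
    refine integral_mono_ae (hCw_int (t + 1))
      (hdiff.add ((hYsq_int t).const_mul _)) ?_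
    filter_upwards [hC5 t, hBnorm] with ω hω hnorm
    have hdescent := hC.le_add_inner_gradient_of_norm_fderiv_gradient_le hC2 (w t ω)
      (-(a t • B t ω (Y t ω)))
    rw [← sub_eq_add_neg, ← hupdate t ω, inner_neg_right, real_inner_smul_right, ← hω.1,
      norm_neg, norm_smul, Real.norm_of_nonneg hat.le] at hdescent
    have hsq : K * (a t * ‖B t ω (Y t ω)‖) ^ 2 ≤ K * (a t * (M * ‖Y t ω‖)) ^ 2 := by
      gcongr
      exact hnorm _
    change C (w (t + 1) ω) ≤ C (w t ω) - a t * ⟪B t ω (G ω), Y t ω⟫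
      + K * M ^ 2 * a t ^ 2 * ‖Y t ω‖ ^ 2
    linarith
  rw [hcross] at hstep
  have h₁ := mul_le_mul_of_nonneg_left hdrift hat.le
  have h₂ := mul_le_mul_of_nonneg_left hsecond (by positivity : 0 ≤ K * M ^ 2 * a t ^ 2)
  have h₃ : a t * (m / D * ((∫ ω, C (w t ω) ∂μ) - C wstar)) =
      ((∫ ω, C (w t ω) ∂μ) - C wstar) * (a t * m / D) := by ring
  linarith
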